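/- Let S be a bounded meet-semilattice (with least element 0 and greatest element 1) satisfying the ascending chain condition and let D be a nonempty subset of S. Then the following are equivalent: (i) D is a deductive system of S, i.e. (Max S) ∩ D ≠ ∅ and for all x, y ∈ S, x ∈ D and (x → y) ∩ D ≠ ∅ imply y ∈ D; (ii) D is a filter of S, i.e. x, y ∈ D implies x ∧ y ∈ D, and x ∈ D together with x ≤ y implies y ∈ D; (iii) the relation Θ(D) := {(x, y) ∈ S × S | ∃ d ∈ D, x ∧ d = y ∧ d} is a congruence of the meet-semilattice S (an equivalence relation compatible with ∧) and D = {x ∈ S | (x, 1) ∈ Θ(D)}. -/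

import Mathlib

/-- The set of maximal elements of `A`. -/
def MaxSet {S : Type*} [PartialOrder S] (A : Set S) : Set S :=
  {m | m ∈ A ∧ ∀ x ∈ A, m ≤ x → x = m}

/-- The ascending chain condition, stated as: every nonempty subset has a maximal element. -/
def AccMax (S : Type*) [PartialOrder S] : Prop :=
  ∀ A : Set S, A.Nonempty → (MaxSet A).Nonempty

/-- Unsharp negation: `a⁰ = Max {x | a ⊓ x = ⊥}`. -/
def UNeg {S : Type*} [SemilatticeInf S] [OrderBot S] (a : S) : Set S :=
  MaxSet {x | a ⊓ x = ⊥}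

/-- Unsharp implication: `a → b = Max {x | a ⊓ x ≤ b}`. -/
def UImp {S : Type*} [SemilatticeInf S] (a b : S) : Set S :=
  MaxSet {x | a ⊓ x ≤ b}

/-- `A ≤₁ B` : every element of `A` lies below some element of `B`. -/
def Le1 {S : Type*} [Preorder S] (A B : Set S) : Prop :=
  ∀ a ∈ A, ∃ b ∈ B, a ≤ b

/-- `A ≈₁ B` : `A ≤₁ B` and `B ≤₁ A`. -/
def Approx1 {S : Type*} [Preorder S] (A B : Set S) : Prop :=
  Le1 A B ∧ Le1 B A

/-- Elementwise meet of two sets: `A ∧ B = {a ⊓ b | a ∈ A, b ∈ B}`. -/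
def MeetSet {S : Type*} [SemilatticeInf S] (A B : Set S) : Set S :=
  {c | ∃ a ∈ A, ∃ b ∈ B, c = a ⊓ b}

/-- Under the ascending chain condition every element of a set lies below a maximal one. -/
theorem AccMax.exists_le_mem_maxSet {S : Type*} [PartialOrder S] (hacc : AccMax S) {A : Set S}
    {a : S} (ha : a ∈ A) : ∃ m ∈ MaxSet A, a ≤ m := by
  obtain ⟨m, ⟨hmA, ham⟩, hmax⟩ := hacc {x | x ∈ A ∧ a ≤ x} ⟨a, ha, le_rfl⟩
  exact ⟨m, ⟨hmA, fun x hx hmx => hmax x ⟨hx, ham.trans hmx⟩ hmx⟩, ham⟩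

theorem stmt19 {S : Type*} [SemilatticeInf S] [OrderBot S] [OrderTop S]
    (hacc : AccMax S) (D : Set S) (hD : D.Nonempty) :
    ((((MaxSet (Set.univ : Set S)) ∩ D).Nonempty ∧
        ∀ x y : S, x ∈ D → (UImp x y ∩ D).Nonempty → y ∈ D) ↔
      ((∀ x ∈ D, ∀ y ∈ D, x ⊓ y ∈ D) ∧ (∀ x ∈ D, ∀ y : S, x ≤ y → y ∈ D)))
    ∧
    (((∀ x ∈ D, ∀ y ∈ D, x ⊓ y ∈ D) ∧ (∀ x ∈ D, ∀ y : S, x ≤ y → y ∈ D)) ↔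
      (Equivalence (fun x y : S => ∃ d ∈ D, x ⊓ d = y ⊓ d) ∧
       (∀ x y z : S, (∃ d ∈ D, x ⊓ d = y ⊓ d) → ∃ d ∈ D, (x ⊓ z) ⊓ d = (y ⊓ z) ⊓ d) ∧
       D = {x : S | ∃ d ∈ D, x ⊓ d = (⊤ : S) ⊓ d})) := by
  refine ⟨⟨?_, ?_⟩, ⟨?_, ?_⟩⟩
  · rintro ⟨⟨t, ⟨-, ht⟩, htD⟩, hmp⟩
    have htop : (⊤ : S) ∈ D := by
      rwa [ht ⊤ (Set.mem_univ _) le_top]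
    have hup : ∀ x ∈ D, ∀ y : S, x ≤ y → y ∈ D := fun x hx y hxy =>
      hmp x y hx ⟨⊤, ⟨inf_le_left.trans hxy, fun _ _ h => top_le_iff.1 h⟩, htop⟩
    refine ⟨fun x hx y hy => ?_, hup⟩
    obtain ⟨m, hm, hxm⟩ :=
      hacc.exists_le_mem_maxSet (A := {z | y ⊓ z ≤ x ⊓ y}) (a := x) (inf_comm y x).le
    exact hmp y (x ⊓ y) hy ⟨m, hm, hup x hx m hxm⟩
  · rintro ⟨hinf, hup⟩
    obtain ⟨d, hd⟩ := hD
    refine ⟨⟨⊤, ⟨Set.mem_univ _, fun _ _ h => top_le_iff.1 h⟩, hup d hd ⊤ le_top⟩, ?_⟩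
    rintro x y hx ⟨z, hz, hzD⟩
    exact hup _ (hinf x hx z hzD) y hz.1
  · rintro ⟨hinf, hup⟩
    refine ⟨⟨fun x => ?_, ?_, ?_⟩, ?_, ?_⟩
    · obtain ⟨d, hd⟩ := hD
      exact ⟨d, hd, rfl⟩
    · rintro x y ⟨d, hd, h⟩
      exact ⟨d, hd, h.symm⟩
    · rintro x y z ⟨d, hd, h⟩ ⟨e, he, h'⟩
      refine ⟨d ⊓ e, hinf d hd e he, ?_⟩
      rw [← inf_assoc, h, inf_assoc, inf_comm d e, ← inf_assoc, h', inf_assoc]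
    · rintro x y z ⟨d, hd, h⟩
      exact ⟨d, hd, by rw [inf_right_comm, h, inf_right_comm]⟩
    · ext x
      constructor
      · exact fun hx => ⟨x, hx, by simp⟩
      · rintro ⟨d, hd, h⟩
        exact hup d hd x (inf_eq_right.1 (by simpa using h))
  · rintro ⟨heq, hcongr, hDeq⟩
    have hmem : ∀ x, x ∈ D ↔ ∃ d ∈ D, x ⊓ d = (⊤ : S) ⊓ d := fun x => Set.ext_iff.1 hDeq x
    refine ⟨fun x hx y hy => (hmem _).2 ?_, fun x hx y hxy => (hmem y).2 ⟨x, hx, by simpa⟩⟩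
    have h := hcongr x ⊤ y ((hmem x).1 hx)
    rw [top_inf_eq] at h
    exact heq.trans h ((hmem y).1 hy)
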